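/- Let p be a prime and let R be a cubic ring that is primitive at p, i.e., the quotient ring R/pR is not isomorphic to the 𝔽_p-algebra 𝔽_p[x,y]/(x², xy, y²) (equivalently, R ≠ ℤ·1 + pR′ for every cubic ring R′). Then the number of unital subrings S ⊆ R whose underlying additive group has index p in that of R is at most 3. -/

import Mathlib

/-- A cubic ring: a commutative ring with unit whose additive group is `ℤ³`,
given by its multiplication and unit (additive maps `ℤ³ → ℤ³` are automatically
`ℤ`-linear, so this is exactly a commutative ring structure on the free `ℤ`-module
of rank 3). -/
structure CubicRingStruct where
  mul : (Fin 3 → ℤ) → (Fin 3 → ℤ) → (Fin 3 → ℤ)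
  one : Fin 3 → ℤ
  mul_comm : ∀ x y, mul x y = mul y x
  mul_assoc : ∀ x y z, mul (mul x y) z = mul x (mul y z)
  one_mul : ∀ x, mul one x = x
  left_distrib : ∀ x y z, mul x (y + z) = mul x y + mul x z

/-- The coordinatewise embedding `ℤ³ → ℚ³`, realizing `R ⊆ R ⊗ ℚ`. -/
def intCast3 (v : Fin 3 → ℤ) : Fin 3 → ℚ := fun i => (v i : ℚ)

/-- The image of `ℤ³` in `ℚ³`, as an additive subgroup. -/
def intLattice : AddSubgroup (Fin 3 → ℚ) where
  carrier := Set.range intCast3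
  zero_mem' := ⟨0, by funext i; simp [intCast3]⟩
  add_mem' := by
    rintro a b ⟨v, rfl⟩ ⟨w, rfl⟩
    exact ⟨v + w, by funext i; simp [intCast3]⟩
  neg_mem' := by
    rintro a ⟨v, rfl⟩
    exact ⟨-v, by funext i; simp [intCast3]⟩

/-- The bilinear extension of the multiplication of a cubic ring to `R ⊗ ℚ = ℚ³`. -/
def mulQ (s : CubicRingStruct) (x y : Fin 3 → ℚ) : Fin 3 → ℚ := fun k =>
  ∑ i : Fin 3, ∑ j : Fin 3,
    x i * y j * ((s.mul (Pi.single i 1) (Pi.single j 1) k : ℤ) : ℚ)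

namespace CubicRingStruct

/-- The underlying type of a cubic ring, a copy of `ℤ³` carrying the ring structure. -/
structure Carrier (s : CubicRingStruct) where
  /-- The coordinate vector. -/
  coords : Fin 3 → ℤ

variable (s : CubicRingStruct)

/-- The identification of `s.Carrier` with `ℤ³`. -/
def coordsEquiv : s.Carrier ≃ (Fin 3 → ℤ) where
  toFun := Carrier.coords
  invFun := Carrier.mk

instance instAddCommGroupCarrier : AddCommGroup s.Carrier := s.coordsEquiv.addCommGroup

protected lemma right_distrib (x y z : Fin 3 → ℤ) : s.mul (x + y) z = s.mul x z + s.mul y z := by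
  rw [s.mul_comm, s.left_distrib, s.mul_comm z x, s.mul_comm z y]

protected lemma mul_zero (x : Fin 3 → ℤ) : s.mul x 0 = 0 := by
  simpa using s.left_distrib x 0 0

protected lemma zero_mul (x : Fin 3 → ℤ) : s.mul 0 x = 0 := by
  rw [s.mul_comm, s.mul_zero]

instance : CommRing s.Carrier where
  __ := s.instAddCommGroupCarrier
  mul x y := ⟨s.mul x.coords y.coords⟩
  one := ⟨s.one⟩
  mul_comm _ _ := congrArg Carrier.mk (s.mul_comm _ _)
  mul_assoc _ _ _ := congrArg Carrier.mk (s.mul_assoc _ _ _)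
  one_mul _ := congrArg Carrier.mk (s.one_mul _)
  mul_one _ := congrArg Carrier.mk ((s.mul_comm _ _).trans (s.one_mul _))
  left_distrib _ _ _ := congrArg Carrier.mk (s.left_distrib _ _ _)
  right_distrib _ _ _ := congrArg Carrier.mk (s.right_distrib _ _ _)
  zero_mul _ := congrArg Carrier.mk (s.zero_mul _)
  mul_zero _ := congrArg Carrier.mk (s.mul_zero _)

/-- The additive group of a cubic ring is `ℤ³`. -/
def equiv : s.Carrier ≃+ (Fin 3 → ℤ) where
  __ := s.coordsEquiv
  map_add' _ _ := rfl

lemma equiv_one : s.equiv 1 = s.one := rfl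

lemma equiv_mul (x y : s.Carrier) : s.equiv (x * y) = s.mul (s.equiv x) (s.equiv y) := rfl

/-- The unit of a cubic ring is the first vector of some `ℤ`-basis. -/
lemma exists_basis_zero_eq_one : ∃ b : Module.Basis (Fin 3) ℤ s.Carrier, b 0 = 1 := by
  let e : Module.Basis (Fin 3) ℤ s.Carrier :=
    (Pi.basisFun ℤ (Fin 3)).map s.equiv.symm.toIntLinearEquiv
  obtain ⟨n, snf⟩ := Submodule.smithNormalForm e (Submodule.span ℤ {(1 : s.Carrier)})
  have hmem : (1 : s.Carrier) ∈ Submodule.span ℤ {(1 : s.Carrier)} :=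
    Submodule.mem_span_singleton_self _
  obtain ⟨j, m, hm⟩ : ∃ (j : Fin 3) (m : ℤ), (1 : s.Carrier) = m • snf.bM j := by
    have : Nontrivial s.Carrier := s.equiv.toEquiv.nontrivial
    have hn : ∀ i j : Fin n, i = j := by
      intro i j
      obtain ⟨u, hu⟩ := Submodule.mem_span_singleton.1 (snf.bN i).2
      obtain ⟨w, hw⟩ := Submodule.mem_span_singleton.1 (snf.bN j).2
      by_contra hij
      have hrel : w • snf.bN i - u • snf.bN j = 0 := by
        apply Subtype.ext
        simp only [Submodule.coe_sub, Submodule.coe_smul, Submodule.coe_zero, ← hu, ← hw]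
        rw [smul_smul, smul_smul, _root_.mul_comm, sub_self]
      have h1 := congrArg (fun x => snf.bN.repr x i) hrel
      have hw0 : w = 0 := by simpa [Ne.symm hij, Finsupp.single_apply] using h1
      apply snf.bN.ne_zero j
      apply Subtype.ext
      rw [← hw, hw0]; simp
    have hsum := snf.bN.sum_repr ⟨1, hmem⟩
    rcases n with _ | n
    · exact absurd (congrArg Subtype.val hsum) (by simp)
    · have : Unique (Fin (n + 1)) := ⟨⟨0⟩, fun i => hn i 0⟩
      refine ⟨snf.f default, snf.bN.repr ⟨1, hmem⟩ default * snf.a default, ?_⟩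
      have h := congrArg Subtype.val hsum
      rw [Fintype.sum_eq_single 0 fun i hi => absurd (hn i 0) hi] at h
      rw [mul_smul, ← snf.snf]
      simpa using h.symm
  have hunit : m * snf.bM.repr (snf.bM j * snf.bM j) j = 1 := by
    have h : snf.bM j = m • (snf.bM j * snf.bM j) := by
      rw [← smul_mul_assoc, ← hm, _root_.one_mul]
    have h2 := congrArg (fun x => snf.bM.repr x j) h
    simpa only [map_smul, Finsupp.smul_apply, Module.Basis.repr_self, Finsupp.single_eq_same,
      smul_eq_mul] using h2.symm
  obtain ⟨v, rfl⟩ := IsUnit.of_mul_eq_one _ hunit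
  let b' := (snf.bM.unitsSMul (fun _ => v)).reindex (Equiv.swap j 0)
  refine ⟨b', ?_⟩
  simp [b', Module.Basis.unitsSMul_apply, hm, Units.smul_def]

/-- A cubic ring has a `ℤ`-basis `1, ω, θ` with `ω * θ ∈ ℤ`. -/
lemma exists_normal_basis : ∃ ω θ : s.Carrier,
    (∀ v : s.Carrier, ∃ x y z : ℤ, v = x + y * ω + z * θ) ∧
    (∀ x y z : ℤ, (x + y * ω + z * θ : s.Carrier) = 0 → x = 0 ∧ y = 0 ∧ z = 0) ∧
    ∃ n : ℤ, ω * θ = n := by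
  obtain ⟨b, hb⟩ := s.exists_basis_zero_eq_one
  have span (v : s.Carrier) : ∃ x y z : ℤ, v = x + y * b 1 + z * b 2 := by
    refine ⟨b.repr v 0, b.repr v 1, b.repr v 2, ?_⟩
    conv_lhs => rw [← b.sum_repr v]
    simp [Fin.sum_univ_three, hb, zsmul_eq_mul]
  have indep (x y z : ℤ) (h : (x + y * b 1 + z * b 2 : s.Carrier) = 0) :
      x = 0 ∧ y = 0 ∧ z = 0 := by
    have h' := Fintype.linearIndependent_iff.1 b.linearIndependent ![x, y, z]
      (by simpa [Fin.sum_univ_three, hb, zsmul_eq_mul] using h)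
    exact ⟨h' 0, h' 1, h' 2⟩
  obtain ⟨n, e, g, h⟩ := span (b 1 * b 2)
  refine ⟨b 1 - g, b 2 - e, fun v => ?_, fun x y z hv => ?_, n + e * g, ?_⟩
  · obtain ⟨x, y, z, hv⟩ := span v
    refine ⟨x + y * g + z * e, y, z, ?_⟩
    rw [hv]; push_cast; ring
  · obtain ⟨h1, h2, h3⟩ := indep (x - y * g - z * e) y z (by rw [← hv]; push_cast; ring)
    subst h2 h3
    simpa using h1
  · push_cast; linear_combination h

/-- The multiplication table of a cubic ring in a normalized basis. -/
lemma exists_normal_form : ∃ (ω θ : s.Carrier) (a b c d : ℤ),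
    (∀ v : s.Carrier, ∃ x y z : ℤ, v = x + y * ω + z * θ) ∧
    (∀ x y z : ℤ, (x + y * ω + z * θ : s.Carrier) = 0 → x = 0 ∧ y = 0 ∧ z = 0) ∧
    ω * θ = -(a * d : ℤ) ∧ ω * ω = -(a * c : ℤ) + b * ω - a * θ ∧
    θ * θ = -(b * d : ℤ) + d * ω - c * θ := by
  obtain ⟨ω, θ, span, indep, n, hn⟩ := s.exists_normal_basis
  obtain ⟨m, b, a, h1⟩ := span (ω * ω)
  obtain ⟨l, d, c, h2⟩ := span (θ * θ)
  have r1 := indep (b * n + a * l) (a * d - n) (m + a * c) (by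
    push_cast
    linear_combination (-θ) * h1 + (-(a : s.Carrier)) * h2 + (ω - b) * hn)
  have r2 := indep (d * m + c * n) (l + d * b) (d * a - n) (by
    push_cast
    linear_combination (-ω) * h2 + (-(d : s.Carrier)) * h1 + (θ - c) * hn)
  refine ⟨ω, θ, -a, b, -c, d, span, indep, ?_, ?_, ?_⟩
  · rw [hn, show n = a * d by linarith [r1.2.1]]; push_cast; ring
  · rw [h1, show m = -(a * c) by linarith [r1.2.2]]; push_cast; ring
  · rw [h2, show l = -(b * d) by linarith [r2.2.1]]; push_cast; ring

end CubicRingStruct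

lemma intCast3_add (u w : Fin 3 → ℤ) : intCast3 (u + w) = intCast3 u + intCast3 w := by
  funext i; simp [intCast3]

lemma intCast3_neg (u : Fin 3 → ℤ) : intCast3 (-u) = -intCast3 u := by
  funext i; simp [intCast3]

lemma intCast3_zsmul (n : ℤ) (u : Fin 3 → ℤ) : intCast3 (n • u) = (n : ℚ) • intCast3 u := by
  funext i; simp [intCast3]

lemma mulQ_smul_smul (s : CubicRingStruct) (q r : ℚ) (x y : Fin 3 → ℚ) :
    mulQ s (q • x) (r • y) = (q * r) • mulQ s x y := by
  funext k
  simp only [mulQ, Pi.smul_apply, smul_eq_mul, Finset.mul_sum]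
  refine Finset.sum_congr rfl fun i _ => Finset.sum_congr rfl fun j _ => ?_
  ring

lemma mulQ_intCast3 (s : CubicRingStruct) (u w : Fin 3 → ℤ) :
    mulQ s (intCast3 u) (intCast3 w) = intCast3 (s.mul u w) := by
  have hsum (v : Fin 3 → ℤ) :
      s.equiv.symm v = ∑ i, v i • s.equiv.symm (Pi.single i 1) := by
    apply s.equiv.injective
    simp only [map_sum, map_zsmul, AddEquiv.apply_symm_apply]
    funext k
    simp [Finset.sum_apply, Pi.single_apply]
  have hmul : s.mul u w = ∑ i, ∑ j, (u i * w j) • s.mul (Pi.single i 1) (Pi.single j 1) := by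
    have h : s.mul u w = s.equiv (s.equiv.symm u * s.equiv.symm w) := by
      rw [s.equiv_mul, AddEquiv.apply_symm_apply, AddEquiv.apply_symm_apply]
    rw [h, hsum u, hsum w, Finset.sum_mul_sum]
    simp only [map_sum, smul_mul_smul_comm, map_zsmul, s.equiv_mul, AddEquiv.apply_symm_apply]
  funext k
  simp [mulQ, intCast3, hmul, Finset.sum_apply]

/-- If the binary cubic form of a cubic ring `R` is divisible by `p`, then `R = ℤ + p R'` for some
cubic ring `R'`. -/
lemma exists_subring_of_form_divisible (s : CubicRingStruct) (p : ℕ) (hp : p ≠ 0)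
    (ω θ : s.Carrier) (a b c d : ℤ)
    (span : ∀ v : s.Carrier, ∃ x y z : ℤ, v = x + y * ω + z * θ)
    (hωθ : ω * θ = -((p * a) * (p * d) : ℤ))
    (hωω : ω * ω = -((p * a) * (p * c) : ℤ) + (p * b : ℤ) * ω - (p * a : ℤ) * θ)
    (hθθ : θ * θ = -((p * b) * (p * d) : ℤ) + (p * d : ℤ) * ω - (p * c : ℤ) * θ) :
    ∃ L : AddSubgroup (Fin 3 → ℚ),
      intCast3 s.one ∈ L ∧ (∀ x ∈ L, ∀ y ∈ L, mulQ s x y ∈ L) ∧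
      (intLattice : Set (Fin 3 → ℚ)) =
        {x | ∃ a : ℤ, ∃ v ∈ L, x = (a : ℚ) • intCast3 s.one + (p : ℚ) • v} := by
  have hp' : (p : ℚ) ≠ 0 := by exact_mod_cast hp
  let L : AddSubgroup (Fin 3 → ℚ) :=
    { carrier := {v | ∃ x y z : ℤ,
        (p : ℚ) • v = intCast3 (s.equiv (p * x + y * ω + z * θ))}
      zero_mem' := ⟨0, 0, 0, by funext i; simp [intCast3]⟩
      add_mem' := by
        rintro v v' ⟨x, y, z, h⟩ ⟨x', y', z', h'⟩
        refine ⟨x + x', y + y', z + z', ?_⟩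
        rw [smul_add, h, h', ← intCast3_add, ← map_add]
        congr 2; push_cast; ring
      neg_mem' := by
        rintro v ⟨x, y, z, h⟩
        refine ⟨-x, -y, -z, ?_⟩
        rw [smul_neg, h, ← intCast3_neg, ← map_neg]
        congr 2; push_cast; ring }
  refine ⟨L, ⟨1, 0, 0, ?_⟩, ?_, ?_⟩
  · have h : (p * (1 : ℤ) + (0 : ℤ) * ω + (0 : ℤ) * θ : s.Carrier) = (p : ℤ) • (1 : s.Carrier) := by
      simp
    rw [h, map_zsmul, intCast3_zsmul, s.equiv_one]
    simp
  · rintro v ⟨x, y, z, h⟩ v' ⟨x', y', z', h'⟩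
    refine ⟨x * x' - a * c * y * y' - a * d * (y * z' + z * y') - b * d * z * z',
      x * y' + x' * y + b * y * y' + d * z * z',
      x * z' + x' * z - a * y * y' - c * z * z', ?_⟩
    apply smul_right_injective _ hp'
    dsimp only
    rw [smul_smul, ← mulQ_smul_smul, h, h', mulQ_intCast3, ← s.equiv_mul]
    have hc := intCast3_zsmul p
    rw [Int.cast_natCast] at hc
    rw [← hc, ← map_zsmul, zsmul_eq_mul]
    congr 2
    push_cast at hωθ hωω hθθ ⊢
    linear_combination (y * z' + z * y' : s.Carrier) * hωθ + (y * y' : s.Carrier) * hωω +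
      (z * z' : s.Carrier) * hθθ
  · ext u
    constructor
    · rintro ⟨w, rfl⟩
      obtain ⟨x, y, z, h⟩ := span (s.equiv.symm w)
      refine ⟨x, (p : ℚ)⁻¹ • intCast3 (s.equiv (y * ω + z * θ)), ⟨0, y, z, ?_⟩, ?_⟩
      · rw [smul_inv_smul₀ hp']
        simp
      · rw [smul_inv_smul₀ hp', ← s.equiv_one, ← intCast3_zsmul, ← map_zsmul, ← intCast3_add,
          ← map_add, zsmul_eq_mul, mul_one, ← add_assoc, ← h, AddEquiv.apply_symm_apply]
    · rintro ⟨n, v, ⟨x, y, z, h⟩, rfl⟩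
      rw [h, ← intCast3_zsmul, ← intCast3_add]
      exact ⟨_, rfl⟩

/-- The line in `𝔽_p²` attached to a point of the projective line. -/
def OnLine {F : Type*} [Field F] : Option F → F → F → Prop
  | none, y, _ => y = 0
  | some t, y, z => z + t * y = 0

lemma exists_line_of_index_eq_prime (s : CubicRingStruct) (p : ℕ) [hp : Fact p.Prime]
    (ω θ : s.Carrier) (span : ∀ v : s.Carrier, ∃ x y z : ℤ, v = x + y * ω + z * θ)
    (M : AddSubgroup (Fin 3 → ℤ)) (hone : s.one ∈ M) (hM : M.index = p) :
    ∃ o : Option (ZMod p), ∀ x y z : ℤ,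
      s.equiv (x + y * ω + z * θ) ∈ M ↔ OnLine o (y : ZMod p) (z : ZMod p) := by
  have hcard : Nat.card ((Fin 3 → ℤ) ⧸ M) = p := hM
  have : IsAddCyclic ((Fin 3 → ℤ) ⧸ M) := isAddCyclic_of_prime_card hcard
  let e : ((Fin 3 → ℤ) ⧸ M) ≃+ ZMod p := ((zmodAddCyclicAddEquiv this).symm).trans
    (ZMod.ringEquivCongr hcard).toAddEquiv
  let φ : s.Carrier →+ ZMod p :=
    (e.toAddMonoidHom.comp (QuotientAddGroup.mk' M)).comp s.equiv.toAddMonoidHom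
  have hφ (v : s.Carrier) : s.equiv v ∈ M ↔ φ v = 0 := by
    simp [φ]
  have hφ1 : φ 1 = 0 := (hφ 1).1 hone
  have hval (x y z : ℤ) : φ (x + y * ω + z * θ) = y * φ ω + z * φ θ := by
    rw [map_add, map_add, ← zsmul_eq_mul, ← zsmul_eq_mul, map_zsmul, map_zsmul,
      ← mul_one (x : s.Carrier), ← zsmul_eq_mul, map_zsmul, hφ1, zsmul_eq_mul, zsmul_eq_mul]
    simp
  by_cases hβ : φ θ = 0
  · have hα : φ ω ≠ 0 := by
      intro hα
      have htop : M = ⊤ := by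
        rw [eq_top_iff]
        intro v _
        obtain ⟨x, y, z, h⟩ := span (s.equiv.symm v)
        have h2 := (hφ (s.equiv.symm v)).2 (by rw [h, hval, hα, hβ]; simp)
        simpa using h2
      rw [htop, AddSubgroup.index_top] at hM
      exact hp.out.one_lt.ne hM
    refine ⟨none, fun x y z => ?_⟩
    rw [hφ, hval, hβ]
    simp [OnLine, hα]
  · refine ⟨some (φ ω / φ θ), fun x y z => ?_⟩
    rw [hφ, hval, OnLine]
    have : (y * φ ω + z * φ θ : ZMod p) = φ θ * (z + φ ω / φ θ * y) := by
      field_simp; ring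
    rw [this, mul_eq_zero, or_iff_right hβ]

/-- The points of the projective line at which a binary cubic form vanishes. -/
def IsFormZero {F : Type*} [Field F] (a b c d : F) : Option F → Prop
  | none => d = 0
  | some t => d * t ^ 3 - c * t ^ 2 + b * t - a = 0

lemma isFormZero_of_mul_mem (s : CubicRingStruct) (p : ℕ) [Fact p.Prime]
    (ω θ : s.Carrier) (a b c d : ℤ)
    (hωθ : ω * θ = -(a * d : ℤ)) (hωω : ω * ω = -(a * c : ℤ) + b * ω - a * θ)
    (hθθ : θ * θ = -(b * d : ℤ) + d * ω - c * θ)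
    (M : AddSubgroup (Fin 3 → ℤ)) (hmul : ∀ x ∈ M, ∀ y ∈ M, s.mul x y ∈ M)
    (o : Option (ZMod p)) (ho : ∀ x y z : ℤ,
      s.equiv (x + y * ω + z * θ) ∈ M ↔ OnLine o (y : ZMod p) (z : ZMod p)) :
    IsFormZero (a : ZMod p) b c d o := by
  cases o with
  | none =>
    have h := (ho 0 0 1).2 (by simp [OnLine])
    have h2 := hmul _ h _ h
    rw [← s.equiv_mul, show (((0 : ℤ) + (0 : ℤ) * ω + (1 : ℤ) * θ) * ((0 : ℤ) + (0 : ℤ) * ω +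
      (1 : ℤ) * θ) : s.Carrier) = (-(b * d) : ℤ) + d * ω + (-c : ℤ) * θ by
        push_cast at hθθ ⊢; linear_combination hθθ, ho] at h2
    exact h2
  | some t =>
    obtain ⟨k, rfl⟩ := ZMod.intCast_surjective t
    have h := (ho 0 1 (-k)).2 (by simp [OnLine])
    have h2 := hmul _ h _ h
    rw [← s.equiv_mul, show (((0 : ℤ) + (1 : ℤ) * ω + (-k : ℤ) * θ) * ((0 : ℤ) + (1 : ℤ) * ω +
      (-k : ℤ) * θ) : s.Carrier) = (-(a * c) + 2 * k * (a * d) - k ^ 2 * (b * d) : ℤ) +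
        (b + k ^ 2 * d : ℤ) * ω + (-a - k ^ 2 * c : ℤ) * θ by
        push_cast at hθθ hωω hωθ ⊢
        linear_combination hωω - 2 * k * hωθ + k ^ 2 * hθθ, ho] at h2
    simp only [OnLine] at h2
    push_cast at h2
    simp only [IsFormZero]
    linear_combination h2

open Polynomial in
/-- A nonzero binary cubic form has at most three zeros on the projective line. -/
lemma exists_finset_isFormZero {F : Type*} [Field F] (a b c d : F)
    (h : ¬(a = 0 ∧ b = 0 ∧ c = 0 ∧ d = 0)) :
    ∃ T : Finset (Option F), T.card ≤ 3 ∧ ∀ o, IsFormZero a b c d o → o ∈ T := by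
  classical
  let P : Cubic F := ⟨d, -c, b, -a⟩
  have hP : P.toPoly ≠ 0 := by
    intro h0
    have := Cubic.toPoly_eq_zero_iff P |>.1 h0
    simp only [P, Cubic.ext_iff] at this
    change d = 0 ∧ -c = 0 ∧ b = 0 ∧ -a = 0 at this
    exact h ⟨neg_eq_zero.1 this.2.2.2, this.2.2.1, neg_eq_zero.1 this.2.1, this.1⟩
  have hroot (t : F) (ht : IsFormZero a b c d (some t)) : t ∈ P.toPoly.roots.toFinset := by
    rw [Multiset.mem_toFinset, Polynomial.mem_roots hP]
    simp only [IsFormZero] at ht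
    simp only [Polynomial.IsRoot, Cubic.toPoly, P, eval_add, eval_mul, eval_C, eval_pow, eval_X]
    linear_combination ht
  have hcard (n : ℕ) (hn : P.toPoly.natDegree ≤ n) :
      (P.toPoly.roots.toFinset.image some).card ≤ n :=
    Finset.card_image_le.trans ((Multiset.toFinset_card_le _).trans
      ((Polynomial.card_roots' _).trans hn))
  by_cases hd : d = 0
  · refine ⟨insert none (P.toPoly.roots.toFinset.image some),
      (Finset.card_insert_le _ _).trans (Nat.succ_le_succ (hcard 2 ?_)), fun o ho => ?_⟩
    · exact Cubic.natDegree_of_a_eq_zero hd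
    · cases o with
      | none => simp
      | some t => exact Finset.mem_insert_of_mem (Finset.mem_image_of_mem _ (hroot t ho))
  · refine ⟨P.toPoly.roots.toFinset.image some, hcard 3 ?_, fun o ho => ?_⟩
    · exact (Cubic.natDegree_of_a_ne_zero hd).le
    · cases o with
      | none => exact absurd ho hd
      | some t => exact Finset.mem_image_of_mem _ (hroot t ho)

theorem at_most_three_index_p_subrings (p : ℕ) (hp : p.Prime) (s : CubicRingStruct)
    (hprim : ¬∃ L : AddSubgroup (Fin 3 → ℚ),
        intCast3 s.one ∈ L ∧ (∀ x ∈ L, ∀ y ∈ L, mulQ s x y ∈ L) ∧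
        (intLattice : Set (Fin 3 → ℚ)) =
          {x | ∃ a : ℤ, ∃ v ∈ L, x = (a : ℚ) • intCast3 s.one + (p : ℚ) • v}) :
    Nat.card { M : AddSubgroup (Fin 3 → ℤ) //
        s.one ∈ M ∧ (∀ x ∈ M, ∀ y ∈ M, s.mul x y ∈ M) ∧ M.index = p } ≤ 3 := by
  obtain ⟨ω, θ, a, b, c, d, span, -, hωθ, hωω, hθθ⟩ := s.exists_normal_form
  have : Fact p.Prime := ⟨hp⟩
  have hne : ¬((a : ZMod p) = 0 ∧ (b : ZMod p) = 0 ∧ (c : ZMod p) = 0 ∧ (d : ZMod p) = 0) := by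
    rintro ⟨ha, hb, hc, hd⟩
    rw [ZMod.intCast_zmod_eq_zero_iff_dvd] at ha hb hc hd
    obtain ⟨a, rfl⟩ := ha
    obtain ⟨b, rfl⟩ := hb
    obtain ⟨c, rfl⟩ := hc
    obtain ⟨d, rfl⟩ := hd
    exact hprim (exists_subring_of_form_divisible s p hp.ne_zero ω θ a b c d span hωθ hωω hθθ)
  obtain ⟨T, hT, hmem⟩ := exists_finset_isFormZero _ _ _ _ hne
  have hline (M : { M : AddSubgroup (Fin 3 → ℤ) //
      s.one ∈ M ∧ (∀ x ∈ M, ∀ y ∈ M, s.mul x y ∈ M) ∧ M.index = p }) :=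
    exists_line_of_index_eq_prime s p ω θ span M.1 M.2.1 M.2.2.2
  choose o ho using hline
  refine (Nat.card_le_card_of_injective (β := T)
    (fun M => ⟨o M, hmem _ (isFormZero_of_mul_mem s p ω θ a b c d hωθ hωω hθθ M.1 M.2.2.1 _ (ho M))⟩)
    fun M M' h => ?_).trans (by simpa using hT)
  have h' : o M = o M' := congrArg Subtype.val h
  apply Subtype.ext
  ext v
  obtain ⟨x, y, z, hv⟩ := span (s.equiv.symm v)
  rw [AddEquiv.symm_apply_eq] at hv
  rw [hv, ho M, ho M', h']
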